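/- arXiv:1612.05568 — 9 statements merged into one kernel-verified Lean document; each statement's English description precedes it below -/
import Mathlib

section
/- Let n be a positive integer, let π ∈ [0, 1], and let p00, p11 ∈ [0, 1] with p00 + p11 > 1. Then the partial derivative of V with respect to p11 at (p00, p11) equals −(2·p00·(1 − p00)·(1 − π) + π·(2·p00·p11 − p00 − p11 + 1)) / ((p00 + p11 − 1)³ · n); in particular this derivative is ≤ 0, and it is strictly negative whenever π > 0 or p00 < 1. -/
/-- The partial derivative of the estimator error
`V(p00, p11) = (1/4 - (p00 - 1/2 - π(p00 + p11 - 1))²)/((p00 + p11 - 1)²·n)`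
with respect to `p11` equals
`-(2·p00·(1 - p00)·(1 - π) + π·(2·p00·p11 - p00 - p11 + 1))/((p00 + p11 - 1)³·n)`;
it is nonpositive, and strictly negative whenever `π > 0` or `p00 < 1`. -/
theorem stmt_4 (n : ℕ) (hn : 0 < n) (π : ℝ) (hπ : π ∈ Set.Icc (0 : ℝ) 1)
    (p00 p11 : ℝ) (hp00 : p00 ∈ Set.Icc (0 : ℝ) 1) (hp11 : p11 ∈ Set.Icc (0 : ℝ) 1)
    (hsum : 1 < p00 + p11) :
    let V : ℝ → ℝ → ℝ := fun a b =>
      (1 / 4 - (a - 1 / 2 - π * (a + b - 1)) ^ 2) / ((a + b - 1) ^ 2 * (n : ℝ))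
    let D : ℝ :=
      -(2 * p00 * (1 - p00) * (1 - π) + π * (2 * p00 * p11 - p00 - p11 + 1)) /
        ((p00 + p11 - 1) ^ 3 * (n : ℝ))
    HasDerivAt (fun b => V p00 b) D p11 ∧ D ≤ 0 ∧ ((0 < π ∨ p00 < 1) → D < 0) := by
  obtain ⟨hπ0, hπ1⟩ := hπ
  obtain ⟨ha0, ha1⟩ := hp00
  obtain ⟨hb0, hb1⟩ := hp11
  intro V D
  have hn' : (0 : ℝ) < n := Nat.cast_pos.mpr hn
  have hs : 0 < p00 + p11 - 1 := by linarith
  have ha : 0 < p00 := by linarith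
  have hb : 0 < p11 := by linarith
  have hden : 0 < (p00 + p11 - 1) ^ 3 * (n : ℝ) := by positivity
  have hq : 0 < 2 * p00 * p11 - p00 - p11 + 1 := by
    have h1 := mul_pos ha hb
    have h2 := mul_nonneg (sub_nonneg.mpr ha1) (sub_nonneg.mpr hb1)
    linarith
  have hfirst : 0 ≤ 2 * p00 * (1 - p00) * (1 - π) :=
    mul_nonneg (mul_nonneg (by linarith) (sub_nonneg.mpr ha1)) (sub_nonneg.mpr hπ1)
  have hsecond : 0 ≤ π * (2 * p00 * p11 - p00 - p11 + 1) := mul_nonneg hπ0 hq.le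
  refine ⟨?_, div_nonpos_of_nonpos_of_nonneg (by linarith) hden.le, fun h => ?_⟩
  · have hlin : HasDerivAt (fun b : ℝ => p00 + b - 1) 1 p11 :=
      ((hasDerivAt_id p11).const_add p00).sub_const 1
    have hnum := (((hlin.const_mul π).const_sub (p00 - 1 / 2)).pow 2).const_sub (1 / 4)
    have hquot := hnum.div ((hlin.pow 2).mul_const (n : ℝ)) (by simp; constructor <;> positivity)
    refine hquot.congr_deriv ?_
    simp only [D, Pi.pow_apply]
    field_simp
    ring
  · refine div_neg_of_neg_of_pos ?_ hden
    rcases hπ0.eq_or_lt with rfl | hπ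
    · have ha1' : p00 < 1 := h.resolve_left (lt_irrefl 0)
      have := mul_pos ha (sub_pos.mpr ha1')
      linarith
    · have := mul_pos hπ hq
      linarith
end

section
/- Let n be a positive integer, let π ∈ [0, 1], and let p00, p11 ∈ [0, 1] with p00 + p11 > 1. Then the partial derivative of V with respect to p00 at (p00, p11) equals −((2·p00·p11 − p00 − p11 + 1)·(1 − π) + 2·p11·π·(1 − p11)) / ((p00 + p11 − 1)³ · n); in particular this derivative is ≤ 0, and it is strictly negative whenever π < 1 or p11 < 1. -/
/-- The partial derivative of the estimator error
`V(p00, p11) = (1/4 - (p00 - 1/2 - π(p00 + p11 - 1))²)/((p00 + p11 - 1)²·n)`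
with respect to `p00` equals
`-((2·p00·p11 - p00 - p11 + 1)·(1 - π) + 2·p11·π·(1 - p11))/((p00 + p11 - 1)³·n)`;
it is nonpositive, and strictly negative whenever `π < 1` or `p11 < 1`. -/
theorem stmt_5 (n : ℕ) (hn : 0 < n) (π : ℝ) (hπ : π ∈ Set.Icc (0 : ℝ) 1)
    (p00 p11 : ℝ) (hp00 : p00 ∈ Set.Icc (0 : ℝ) 1) (hp11 : p11 ∈ Set.Icc (0 : ℝ) 1)
    (hsum : 1 < p00 + p11) :
    let V : ℝ → ℝ → ℝ := fun a b =>
      (1 / 4 - (a - 1 / 2 - π * (a + b - 1)) ^ 2) / ((a + b - 1) ^ 2 * (n : ℝ))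
    let D : ℝ :=
      -((2 * p00 * p11 - p00 - p11 + 1) * (1 - π) + 2 * p11 * π * (1 - p11)) /
        ((p00 + p11 - 1) ^ 3 * (n : ℝ))
    HasDerivAt (fun a => V a p11) D p00 ∧ D ≤ 0 ∧ ((π < 1 ∨ p11 < 1) → D < 0) := by
  intro V D
  obtain ⟨hπ0, hπ1⟩ := hπ
  obtain ⟨ha0, ha1⟩ := hp00
  obtain ⟨hb0, hb1⟩ := hp11
  have hn' : (0 : ℝ) < n := Nat.cast_pos.mpr hn
  have hs : 0 < p00 + p11 - 1 := by linarith
  have hden : 0 < (p00 + p11 - 1) ^ 3 * (n : ℝ) := by positivity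
  have ha : 0 < p00 := by linarith
  have hb : 0 < p11 := by linarith
  have hcoef : 0 < 2 * p00 * p11 - p00 - p11 + 1 := by
    nlinarith [mul_pos ha hb, mul_nonneg (sub_nonneg.mpr ha1) (sub_nonneg.mpr hb1)]
  have hfst : 0 ≤ (2 * p00 * p11 - p00 - p11 + 1) * (1 - π) :=
    mul_nonneg hcoef.le (sub_nonneg.mpr hπ1)
  have hsnd : 0 ≤ 2 * p11 * π * (1 - p11) :=
    mul_nonneg (by positivity) (sub_nonneg.mpr hb1)
  refine ⟨?_, div_nonpos_of_nonpos_of_nonneg (by linarith) hden.le, fun h => ?_⟩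
  · have hshift : HasDerivAt (fun a : ℝ => a + p11 - 1) 1 p00 :=
      ((hasDerivAt_id p00).add_const p11).sub_const 1
    have hnum := (((((hasDerivAt_id p00).sub_const (1 / 2)).sub
      (hshift.const_mul π)).pow 2).const_sub (1 / 4))
    refine (hnum.div ((hshift.pow 2).mul_const (n : ℝ)) (mul_pos (pow_pos hs 2) hn').ne').congr_deriv ?_
    have hs' := hs.ne'
    simp [D]
    field_simp
    ring
  · refine div_neg_of_neg_of_pos ?_ hden
    rcases hπ1.lt_or_eq with hlt | rfl
    · linarith [mul_pos hcoef (sub_pos.mpr hlt)]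
    · have hb1' : p11 < 1 := h.resolve_left (lt_irrefl _)
      linarith [mul_pos hb (sub_pos.mpr hb1')]
end

section
/- Let ε > 0, let n be a positive integer, and let π ∈ [0, 1]. Define s(t) = e^ε·t/(1 + e^ε) and r(t) = 1 − e^{−ε}·s(t). Then the map t ↦ V(r(t), s(t), π, n) is strictly decreasing on (0, 1]; indeed its derivative equals −(1 + e^ε)(1 + π(e^ε − 1)) / ((e^ε − 1)²·t²·n) < 0 for every t ∈ (0, 1]. -/
/-- Closed form of the estimator error along the boundary, with `x = eᵉ`. -/
theorem estimatorError_boundary_eq {x m t : ℝ} (p : ℝ) (hx : 1 < x) (hm : m ≠ 0) (ht : t ≠ 0) :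
    (1 / 4 - (1 - x⁻¹ * (x * t / (1 + x)) - 1 / 2 -
        p * (1 - x⁻¹ * (x * t / (1 + x)) + x * t / (1 + x) - 1)) ^ 2) /
      ((1 - x⁻¹ * (x * t / (1 + x)) + x * t / (1 + x) - 1) ^ 2 * m) =
    (1 + x) * (1 + p * (x - 1)) / ((x - 1) ^ 2 * m) * t⁻¹ -
      (1 + p * (x - 1)) ^ 2 / ((x - 1) ^ 2 * m) := by
  have h0 : x ≠ 0 := by linarith
  have h1 : x - 1 ≠ 0 := by linarith
  have h2 : 1 + x ≠ 0 := by linarith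
  have hr : x⁻¹ * (x * t / (1 + x)) = t / (1 + x) := by field_simp
  have hc : 1 - t / (1 + x) + x * t / (1 + x) - 1 = (x - 1) * t / (1 + x) := by
    field_simp
    ring
  rw [hr, hc]
  field_simp
  ring

/-- Along the boundary `p00 = r(t) = 1 - e⁻ᵉ·s(t)`, `p11 = s(t) = eᵉ·t/(1 + eᵉ)`,
the estimator error is strictly decreasing in `t` on `(0, 1]`; its derivative equals
`-(1 + eᵉ)(1 + π(eᵉ - 1))/((eᵉ - 1)²·t²·n) < 0` for every `t ∈ (0, 1]`. -/
theorem stmt_7 (ε : ℝ) (hε : 0 < ε) (n : ℕ) (hn : 0 < n)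
    (π : ℝ) (hπ : π ∈ Set.Icc (0 : ℝ) 1) :
    let V : ℝ → ℝ → ℝ := fun a b =>
      (1 / 4 - (a - 1 / 2 - π * (a + b - 1)) ^ 2) / ((a + b - 1) ^ 2 * (n : ℝ))
    let s : ℝ → ℝ := fun t => Real.exp ε * t / (1 + Real.exp ε)
    let r : ℝ → ℝ := fun t => 1 - Real.exp (-ε) * s t
    (∀ t ∈ Set.Ioc (0 : ℝ) 1,
      HasDerivAt (fun u => V (r u) (s u))
        (-((1 + Real.exp ε) * (1 + π * (Real.exp ε - 1))) /
          ((Real.exp ε - 1) ^ 2 * t ^ 2 * (n : ℝ))) t ∧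
      -((1 + Real.exp ε) * (1 + π * (Real.exp ε - 1))) /
          ((Real.exp ε - 1) ^ 2 * t ^ 2 * (n : ℝ)) < 0) ∧
    StrictAntiOn (fun t => V (r t) (s t)) (Set.Ioc (0 : ℝ) 1) := by
  intro V s r
  have hx : 1 < Real.exp ε := Real.one_lt_exp_iff.mpr hε
  have hm : (0 : ℝ) < n := Nat.cast_pos.mpr hn
  have hx' : 0 < Real.exp ε - 1 := sub_pos.mpr hx
  have hk : 0 < 1 + π * (Real.exp ε - 1) := by
    have := mul_nonneg hπ.1 hx'.le
    linarith
  have hV : ∀ t : ℝ, t ≠ 0 → V (r t) (s t) =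
      (1 + Real.exp ε) * (1 + π * (Real.exp ε - 1)) / ((Real.exp ε - 1) ^ 2 * n) * t⁻¹ -
        (1 + π * (Real.exp ε - 1)) ^ 2 / ((Real.exp ε - 1) ^ 2 * n) := by
    intro t ht
    simp only [V, r, s, Real.exp_neg]
    exact estimatorError_boundary_eq π hx hm.ne' ht
  refine ⟨fun t ht => ⟨?_, ?_⟩, fun t ht u hu htu => ?_⟩
  · have ht0 : t ≠ 0 := ht.1.ne'
    have hd := ((hasDerivAt_inv ht0).const_mul ((1 + Real.exp ε) * (1 + π * (Real.exp ε - 1)) /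
      ((Real.exp ε - 1) ^ 2 * n))).sub_const
        ((1 + π * (Real.exp ε - 1)) ^ 2 / ((Real.exp ε - 1) ^ 2 * n))
    refine (hd.congr_of_eventuallyEq ?_).congr_deriv ?_
    · filter_upwards [isOpen_ne.mem_nhds ht0] with u hu using hV u hu
    · field_simp
  · have ht0 := ht.1
    exact div_neg_of_neg_of_pos (neg_neg_of_pos (by positivity)) (by positivity)
  · have ht0 := ht.1
    change V (r u) (s u) < V (r t) (s t)
    rw [hV t ht0.ne', hV u hu.1.ne']
    gcongr
end

section
/- Let ε > 0, let n be a positive integer, and let π ∈ [0, 1]. Define s(t) = e^ε·t/(1 + e^ε) and r(t) = 1 − e^{−ε}·s(t). Then the map t ↦ V(s(t), r(t), π, n) is strictly decreasing on (0, 1]; indeed its derivative equals −(1 + e^ε)(1 + (1 − π)(e^ε − 1)) / ((e^ε − 1)²·t²·n) < 0 for every t ∈ (0, 1]. -/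
/-- Along the boundary `p00 = s(t) = eᵉ·t/(1 + eᵉ)`, `p11 = r(t) = 1 - e⁻ᵉ·s(t)`,
the estimator error is strictly decreasing in `t` on `(0, 1]`; its derivative equals
`-(1 + eᵉ)(1 + (1 - π)(eᵉ - 1))/((eᵉ - 1)²·t²·n) < 0` for every `t ∈ (0, 1]`. -/
theorem stmt_8 (ε : ℝ) (hε : 0 < ε) (n : ℕ) (hn : 0 < n)
    (π : ℝ) (hπ : π ∈ Set.Icc (0 : ℝ) 1) :
    let V : ℝ → ℝ → ℝ := fun a b =>
      (1 / 4 - (a - 1 / 2 - π * (a + b - 1)) ^ 2) / ((a + b - 1) ^ 2 * (n : ℝ))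
    let s : ℝ → ℝ := fun t => Real.exp ε * t / (1 + Real.exp ε)
    let r : ℝ → ℝ := fun t => 1 - Real.exp (-ε) * s t
    (∀ t ∈ Set.Ioc (0 : ℝ) 1,
      HasDerivAt (fun u => V (s u) (r u))
        (-((1 + Real.exp ε) * (1 + (1 - π) * (Real.exp ε - 1))) /
          ((Real.exp ε - 1) ^ 2 * t ^ 2 * (n : ℝ))) t ∧
      -((1 + Real.exp ε) * (1 + (1 - π) * (Real.exp ε - 1))) /
          ((Real.exp ε - 1) ^ 2 * t ^ 2 * (n : ℝ)) < 0) ∧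
    StrictAntiOn (fun t => V (s t) (r t)) (Set.Ioc (0 : ℝ) 1) := by
  intro V s r
  have hE : 1 < Real.exp ε := Real.one_lt_exp_iff.mpr hε
  have hn' : (0 : ℝ) < n := Nat.cast_pos.mpr hn
  have hneg : Real.exp (-ε) = (Real.exp ε)⁻¹ := Real.exp_neg ε
  have hm : 0 < 1 + (1 - π) * (Real.exp ε - 1) := by
    have := mul_nonneg (sub_nonneg.mpr hπ.2) (sub_nonneg.mpr hE.le)
    linarith
  have hV : ∀ u : ℝ, u ≠ 0 → V (s u) (r u) =
      (1 + Real.exp ε) * (1 + (1 - π) * (Real.exp ε - 1)) / ((Real.exp ε - 1) ^ 2 * n) * u⁻¹ +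
        -(1 + (1 - π) * (Real.exp ε - 1)) ^ 2 / ((Real.exp ε - 1) ^ 2 * n) := by
    intro u hu
    simp only [V, r, s, hneg]
    generalize Real.exp ε = E at hE
    have h0 : E ≠ 0 := by positivity
    have h1 : 1 + E ≠ 0 := by positivity
    have h2 : E - 1 ≠ 0 := (sub_pos.mpr hE).ne'
    have hd : E * u / (1 + E) + (1 - E⁻¹ * (E * u / (1 + E))) - 1 = (E - 1) * u / (1 + E) := by
      field_simp
      ring
    rw [hd]
    field_simp
    ring
  generalize Real.exp ε = E at hE hm hV ⊢
  have h1 : 0 < 1 + E := by linarith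
  have h2 : 0 < E - 1 := sub_pos.mpr hE
  refine ⟨fun t ht => ⟨?_, ?_⟩, fun x hx y hy hxy => ?_⟩
  · have ht0 : t ≠ 0 := ht.1.ne'
    have hderiv := ((hasDerivAt_inv ht0).const_mul
      ((1 + E) * (1 + (1 - π) * (E - 1)) / ((E - 1) ^ 2 * n))).add_const
        (-(1 + (1 - π) * (E - 1)) ^ 2 / ((E - 1) ^ 2 * n))
    refine (hderiv.congr_of_eventuallyEq ?_).congr_deriv ?_
    · filter_upwards [eventually_ne_nhds ht0] with u hu using hV u hu
    · field_simp
  · have := ht.1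
    exact div_neg_of_neg_of_pos (neg_neg_of_pos (by positivity)) (by positivity)
  · simp only [hV x hx.1.ne', hV y hy.1.ne']
    have hinv : y⁻¹ < x⁻¹ := inv_strictAnti₀ hx.1 hxy
    gcongr
end

section
/- Let ε > 0, let n be a positive integer, and let π ∈ (0, 1). Set p* = e^ε/(e^ε + 1). Then (p*, p*) ∈ R'(ε, 0), and for every (p00, p11) ∈ R'(ε, 0) with (p00, p11) ≠ (p*, p*) one has V(p00, p11, π, n) > V(p*, p*, π, n); i.e., the design matrix with p00 = p11 = e^ε/(e^ε + 1) is the unique ε-differentially private randomised response mechanism minimising the estimator error. -/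
/-- The estimator error factors through the ratios of the error probabilities `1 - b`, `1 - a`
to `a + b - 1`. -/
lemma estimatorError_eq (a b π n : ℝ) (hs : a + b - 1 ≠ 0) :
    (1 / 4 - (a - 1 / 2 - π * (a + b - 1)) ^ 2) / ((a + b - 1) ^ 2 * n) =
      ((1 - b) / (a + b - 1) + (1 - π)) * ((1 - a) / (a + b - 1) + π) / n := by
  rw [div_mul_eq_div_div]
  congr 1
  field_simp
  ring

/-- The privacy constraint `a ≤ E * (1 - b)` bounds an error ratio from below. -/
lemma inv_sub_one_le_errorRatio {E a b : ℝ} (hE : 1 < E) (hs : 0 < a + b - 1)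
    (h : a ≤ E * (1 - b)) : 1 / (E - 1) ≤ (1 - b) / (a + b - 1) := by
  rw [div_le_div_iff₀ (by linarith) hs]
  linarith

/-- If both error ratios take their minimal value, the mechanism is the symmetric one. -/
lemma eq_of_errorRatio_eq {E a b : ℝ} (hE : 1 < E) (hs : 0 < a + b - 1)
    (hu : 1 / (E - 1) = (1 - b) / (a + b - 1)) (hv : 1 / (E - 1) = (1 - a) / (a + b - 1)) :
    a = E / (E + 1) ∧ b = E / (E + 1) := by
  have hE' : E - 1 ≠ 0 := by linarith
  rw [div_eq_div_iff hE' hs.ne'] at hu hv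
  have hab : a = b := mul_left_cancel₀ hE' (by linarith)
  subst hab
  have ha : a = E / (E + 1) := by
    rw [eq_div_iff (by linarith)]
    linarith
  exact ⟨ha, ha⟩

/-- For `ε > 0` and `π ∈ (0, 1)`, the mechanism with `p00 = p11 = eᵉ/(eᵉ + 1)` is the
unique ε-differentially private (i.e. (ε, 0)-differentially private) randomised response
mechanism minimising the estimator error over the feasible region `R'(ε, 0)`. -/
theorem stmt_9 (ε : ℝ) (hε : 0 < ε) (n : ℕ) (hn : 0 < n)
    (π : ℝ) (hπ : π ∈ Set.Ioo (0 : ℝ) 1) :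
    let V : ℝ → ℝ → ℝ := fun a b =>
      (1 / 4 - (a - 1 / 2 - π * (a + b - 1)) ^ 2) / ((a + b - 1) ^ 2 * (n : ℝ))
    let R' : Set (ℝ × ℝ) := {p : ℝ × ℝ |
      p.1 ≤ 1 ∧ p.2 ≤ 1 ∧ 1 < p.1 + p.2 ∧
      p.1 ≤ Real.exp ε * (1 - p.2) + 0 ∧ p.2 ≤ Real.exp ε * (1 - p.1) + 0}
    let pStar : ℝ := Real.exp ε / (Real.exp ε + 1)
    (pStar, pStar) ∈ R' ∧
    ∀ p ∈ R', p ≠ (pStar, pStar) → V pStar pStar < V p.1 p.2 := by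
  intro V R' pStar
  have hE : 1 < Real.exp ε := Real.one_lt_exp_iff.mpr hε
  set E := Real.exp ε
  have hn' : (0 : ℝ) < n := Nat.cast_pos.mpr hn
  have hE1 : E + 1 ≠ 0 := by linarith
  have hE2 : E - 1 ≠ 0 := by linarith
  have hc : 1 - pStar = 1 / (E + 1) := by
    simp only [pStar]
    field_simp
    ring
  have hs : pStar + pStar - 1 = (E - 1) / (E + 1) := by
    simp only [pStar]
    field_simp
    ring
  have hspos : 0 < pStar + pStar - 1 := by
    rw [hs]
    exact div_pos (by linarith) (by linarith)
  have hcpos : 0 < 1 - pStar := by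
    rw [hc]
    exact div_pos one_pos (by linarith)
  have hp : pStar = E * (1 - pStar) := by
    rw [hc, mul_one_div]
  have hk : (1 - pStar) / (pStar + pStar - 1) = 1 / (E - 1) := by
    rw [hc, hs]
    field_simp
  refine ⟨⟨by linarith, by linarith, by linarith, ?_, ?_⟩, ?_⟩
  · rw [add_zero]
    exact hp.le
  · rw [add_zero]
    exact hp.le
  rintro ⟨a, b⟩ ⟨-, -, hab, h₁, h₂⟩ hne
  simp only [add_zero] at hab h₁ h₂
  have hab' : 0 < a + b - 1 := by linarith
  have hu := inv_sub_one_le_errorRatio hE hab' h₁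
  have hv : 1 / (E - 1) ≤ (1 - a) / (a + b - 1) := by
    rw [add_comm a b] at hab' ⊢
    exact inv_sub_one_le_errorRatio hE hab' h₂
  have hkpos : 0 < 1 / (E - 1) := div_pos one_pos (by linarith)
  have h0 := hπ.1
  have h1 := hπ.2
  simp only [V]
  rw [estimatorError_eq _ _ _ _ hspos.ne', estimatorError_eq _ _ _ _ hab'.ne', hk]
  apply div_lt_div_of_pos_right _ hn'
  rcases hu.lt_or_eq with hu' | hu'
  · exact mul_lt_mul (by linarith) (by linarith) (by linarith) (by linarith)
  rcases hv.lt_or_eq with hv' | hv'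
  · exact mul_lt_mul' (by linarith) (by linarith) (by linarith) (by linarith)
  obtain ⟨ha, hb⟩ := eq_of_errorRatio_eq hE hab' hu' hv'
  exact absurd (Prod.ext ha hb) hne
end

section
/- Let ε ≥ 0, δ > 0, let n be a positive integer, let π ∈ [0, 1], and let 0 ≤ a ≤ b ≤ 1. Define s_δ(t) = t(e^ε + δ)/(e^ε + 1) and r_δ(t) = 1 − e^{−ε}(s_δ(t) − δ). Then for every t ∈ (a, b), V(r_δ(t), s_δ(t), π, n) > min( V(r_δ(a), s_δ(a), π, n), V(r_δ(b), s_δ(b), π, n) ); in particular, the minimum of t ↦ V(r_δ(t), s_δ(t), π, n) over [a, b] is attained only at a or at b. -/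
/-- A quadratic over the square of a positive affine function `D`, specialised to the boundary
curve: its interior values strictly exceed the smaller endpoint value. -/
theorem min_lt_boundary_error {q δ p u s v : ℝ} (hq : 0 < q) (hq1 : q ≤ 1) (hδ : 0 < δ)
    (hu : 0 ≤ u) (hus : u < s) (hsv : s < v) {D F : ℝ → ℝ}
    (hD : ∀ x, D x = x * (1 - q) + q * δ)
    (hF : ∀ x, F x = (q * (x - δ) + p * D x) * (1 - (q * (x - δ) + p * D x)) / D x ^ 2) :
    min (F u) (F v) < F s := by
  have D_pos : ∀ x, 0 ≤ x → 0 < D x := fun x hx => by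
    have := mul_nonneg hx (sub_nonneg.2 hq1)
    have := mul_pos hq hδ
    rw [hD]; linarith
  have hDu := D_pos u hu
  have hDs := D_pos s (by linarith)
  have hDv := D_pos v (by linarith)
  have hA : 0 < s - u := sub_pos.2 hus
  have hB : 0 < v - s := sub_pos.2 hsv
  have hL : 0 < v - u := by linarith
  have hK : 0 < q * δ * (1 - q + q * δ) := by
    have := mul_pos hq hδ
    exact mul_pos this (by linarith)
  set l := (v - s) * D u / (D s * (v - u)) with hl
  set r := (s - u) * D v / (D s * (v - u)) with hr
  have hl0 : 0 < l := by positivity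
  have hr0 : 0 < r := by positivity
  have hlr : l + r = 1 := by
    rw [hl, hr, ← add_div, div_eq_one_iff_eq (by positivity), hD, hD, hD]
    ring
  have key : F s = l * F u + r * F v
      + (v - s) * (s - u) * (q * δ * (1 - q + q * δ)) / (D s ^ 2 * D u * D v) := by
    rw [hF, hF, hF, hl, hr]
    field_simp
    simp only [hD]
    ring
  have hpos : 0 < (v - s) * (s - u) * (q * δ * (1 - q + q * δ)) / (D s ^ 2 * D u * D v) := by
    positivity
  have h1 := mul_le_mul_of_nonneg_left (min_le_left (F u) (F v)) hl0.le
  have h2 := mul_le_mul_of_nonneg_left (min_le_right (F u) (F v)) hr0.le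
  have h3 : l * min (F u) (F v) + r * min (F u) (F v) = min (F u) (F v) := by
    rw [← add_mul, hlr, one_mul]
  linarith

/-- Along the boundary curve `p00 = r_δ(t)`, `p11 = s_δ(t)`, the estimator error at any
interior point of an interval `[a, b] ⊆ [0, 1]` strictly exceeds the smaller of its values
at the endpoints; hence the minimum over `[a, b]` is attained only at `a` or `b`. -/
theorem stmt_10 (ε δ : ℝ) (hε : 0 ≤ ε) (hδ : 0 < δ) (n : ℕ) (hn : 0 < n)
    (π : ℝ) (hπ : π ∈ Set.Icc (0 : ℝ) 1)
    (a b : ℝ) (ha : 0 ≤ a) (hab : a ≤ b) (hb : b ≤ 1) :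
    let V : ℝ → ℝ → ℝ := fun x y =>
      (1 / 4 - (x - 1 / 2 - π * (x + y - 1)) ^ 2) / ((x + y - 1) ^ 2 * (n : ℝ))
    let sδ : ℝ → ℝ := fun t => t * (Real.exp ε + δ) / (Real.exp ε + 1)
    let rδ : ℝ → ℝ := fun t => 1 - Real.exp (-ε) * (sδ t - δ)
    ∀ t ∈ Set.Ioo a b,
      min (V (rδ a) (sδ a)) (V (rδ b) (sδ b)) < V (rδ t) (sδ t) := by
  intro V sδ rδ t ht
  have hn' : (0 : ℝ) < n := Nat.cast_pos.2 hn
  have hc : 0 < (Real.exp ε + δ) / (Real.exp ε + 1) := by positivity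
  have hs : ∀ x, sδ x = x * ((Real.exp ε + δ) / (Real.exp ε + 1)) := fun x => mul_div_assoc _ _ _
  have mono : ∀ {x y : ℝ}, x < y → sδ x < sδ y := fun {x y} h => by
    rw [hs, hs]; exact mul_lt_mul_of_pos_right h hc
  have hV : ∀ x, V (rδ x) (sδ x) =
      (Real.exp (-ε) * (sδ x - δ) + π * (sδ x * (1 - Real.exp (-ε)) + Real.exp (-ε) * δ)) *
        (1 - (Real.exp (-ε) * (sδ x - δ)
          + π * (sδ x * (1 - Real.exp (-ε)) + Real.exp (-ε) * δ))) /
        (sδ x * (1 - Real.exp (-ε)) + Real.exp (-ε) * δ) ^ 2 / n := fun x => by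
    simp only [V, rδ]
    rw [div_div]
    congr 1 <;> ring
  rw [hV, hV, hV, min_div_div_right hn'.le]
  refine div_lt_div_of_pos_right ?_ hn'
  exact min_lt_boundary_error (Real.exp_pos _) (Real.exp_le_one_iff.2 (neg_nonpos.2 hε)) hδ
    (by rw [hs]; positivity) (mono ht.1) (mono ht.2)
    (D := fun y => y * (1 - Real.exp (-ε)) + Real.exp (-ε) * δ)
    (F := fun y => (Real.exp (-ε) * (y - δ) + π * (y * (1 - Real.exp (-ε)) + Real.exp (-ε) * δ)) *
        (1 - (Real.exp (-ε) * (y - δ) + π * (y * (1 - Real.exp (-ε)) + Real.exp (-ε) * δ))) /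
        (y * (1 - Real.exp (-ε)) + Real.exp (-ε) * δ) ^ 2)
    (fun _ => rfl) (fun _ => rfl)
end

section
/- Let ε ≥ 0, δ > 0, let n be a positive integer, and let t ∈ [0, 1]. Define s_δ(t) = t(e^ε + δ)/(e^ε + 1) and r_δ(t) = 1 − e^{−ε}(s_δ(t) − δ). If π ≤ 1/2 then V(r_δ(t), s_δ(t), π, n) ≤ V(s_δ(t), r_δ(t), π, n), and if π ≥ 1/2 then V(r_δ(t), s_δ(t), π, n) ≥ V(s_δ(t), r_δ(t), π, n). -/
/-- If `0 ≤ x + y - 1`, exchanging the arguments does not decrease the estimator error as soon as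
`(x - y) * (1 - 2 * π)` is nonnegative. -/
theorem estimatorError_le_swap {x y π N : ℝ} (hN : 0 ≤ N) (hxy : 0 ≤ x + y - 1)
    (h : 0 ≤ (x - y) * (1 - 2 * π)) :
    (1 / 4 - (x - 1 / 2 - π * (x + y - 1)) ^ 2) / ((x + y - 1) ^ 2 * N) ≤
      (1 / 4 - (y - 1 / 2 - π * (y + x - 1)) ^ 2) / ((y + x - 1) ^ 2 * N) := by
  rw [add_comm y x]
  refine div_le_div_of_nonneg_right ?_ (by positivity)
  linarith [mul_nonneg h hxy]

/-- Along the boundary parametrisation `r_δ, s_δ`, for `π ≤ 1/2` the estimator error on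
the branch `(r_δ(t), s_δ(t))` is at most that on the branch `(s_δ(t), r_δ(t))`, and the
reverse inequality holds for `π ≥ 1/2`. -/
theorem stmt_11 (ε δ : ℝ) (hε : 0 ≤ ε) (hδ : 0 < δ) (n : ℕ) (hn : 0 < n)
    (π : ℝ) (t : ℝ) (ht : t ∈ Set.Icc (0 : ℝ) 1) :
    let V : ℝ → ℝ → ℝ := fun x y =>
      (1 / 4 - (x - 1 / 2 - π * (x + y - 1)) ^ 2) / ((x + y - 1) ^ 2 * (n : ℝ))
    let sδ : ℝ → ℝ := fun u => u * (Real.exp ε + δ) / (Real.exp ε + 1)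
    let rδ : ℝ → ℝ := fun u => 1 - Real.exp (-ε) * (sδ u - δ)
    (π ≤ 1 / 2 → V (rδ t) (sδ t) ≤ V (sδ t) (rδ t)) ∧
    (1 / 2 ≤ π → V (sδ t) (rδ t) ≤ V (rδ t) (sδ t)) := by
  intro V s r
  have hE : 1 ≤ Real.exp ε := Real.one_le_exp hε
  have hE0 : 0 < Real.exp ε := Real.exp_pos ε
  have hmul : Real.exp (-ε) * Real.exp ε = 1 := by rw [← Real.exp_add]; simp
  have hinv : Real.exp (-ε) ≤ 1 := Real.exp_le_one_iff.2 (by linarith)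
  have hinv0 : 0 < Real.exp (-ε) := Real.exp_pos _
  have hs0 : 0 ≤ s t := div_nonneg (mul_nonneg ht.1 (by linarith)) (by linarith)
  have hs : s t * (Real.exp ε + 1) ≤ Real.exp ε + δ := by
    have : s t * (Real.exp ε + 1) = t * (Real.exp ε + δ) :=
      div_mul_cancel₀ _ (by linarith)
    rw [this]
    exact mul_le_of_le_one_left (by linarith) ht.2
  have hr : r t = 1 - Real.exp (-ε) * (s t - δ) := rfl
  have hsum : 0 ≤ r t + s t - 1 := by
    rw [hr]
    linarith [mul_pos hinv0 hδ, mul_nonneg hs0 (sub_nonneg.2 hinv)]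
  have hle : s t ≤ r t := by
    have h := mul_le_mul_of_nonneg_left hs hinv0.le
    rw [hr]
    linear_combination h + (1 - s t) * hmul
  have hN : (0 : ℝ) ≤ n := n.cast_nonneg
  refine ⟨fun hπ => estimatorError_le_swap hN hsum ?_, fun hπ =>
    estimatorError_le_swap hN (by linarith) ?_⟩
  · exact mul_nonneg (by linarith) (by linarith)
  · exact mul_nonneg_of_nonpos_of_nonpos (by linarith) (by linarith)
end

section
/- Let ε ≥ 0, 0 < δ ≤ 1, let n be a positive integer, and let π ∈ (0, 1/2]. Define g(ε, δ) = δ(e^ε + δ)/(e^ε + 2δ − 1)² and p* = (e^ε + δ)/(e^ε + 1). If g(ε, δ) < π, then (p*, p*) ∈ R'(ε, δ) and for every (p00, p11) ∈ R'(ε, δ) with (p00, p11) ≠ (p*, p*) one has V(p00, p11, π, n) > V(p*, p*, π, n); i.e., the mechanism with p00 = p11 = (e^ε + δ)/(e^ε + 1) is the unique (ε, δ)-differentially private randomised response mechanism minimising the estimator error. -/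
/-- On the part `A ≤ m` of the half-plane `m * (c + d) ≤ c * A + d * B`, the product
`(A + q) * (B + 1 - q)` is uniquely minimised at the corner `(m, m)`. -/
theorem mul_add_lt_mul_add_of_le_corner {c d m q A B : ℝ} (hc : 0 ≤ c) (hd : 0 < d)
    (hq : 0 < q) (hA : 0 ≤ A) (hAm : A ≤ m) (hAB : m * (c + d) ≤ c * A + d * B)
    (hm : d * (m + 1) < (c + d) * q) (hne : A = m → B ≠ m) :
    (m + q) * (m + (1 - q)) < (A + q) * (B + (1 - q)) := by
  have key : d * ((A + q) * (B + (1 - q)) - (m + q) * (m + (1 - q))) =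
      (A + q) * (c * A + d * B - m * (c + d)) +
        (m - A) * (((c + d) * q - d * (m + 1)) + c * A) := by ring
  have hcA : 0 ≤ c * A := mul_nonneg hc hA
  suffices h : 0 < d * ((A + q) * (B + (1 - q)) - (m + q) * (m + (1 - q))) by
    linarith [pos_of_mul_pos_right h hd.le]
  rw [key]
  rcases hAm.lt_or_eq with h | h
  · exact add_pos_of_nonneg_of_pos (mul_nonneg (by linarith) (by linarith))
      (mul_pos (by linarith) (by linarith))
  · subst h
    have hB : A < B := by
      refine lt_of_le_of_ne ?_ (hne rfl).symm
      exact le_of_mul_le_mul_left (by linarith) hd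
    have : 0 < (A + q) * (d * (B - A)) :=
      mul_pos (by linarith) (mul_pos hd (by linarith))
    linarith

/-- The product `(A + q) * (B + (1 - q))` is uniquely minimised at `(m, m)` over the intersection
of two half-planes that meet in this point and are exchanged by swapping `A` and `B`. -/
theorem mul_add_lt_mul_add_of_corner {c d m q A B : ℝ} (hc : 0 ≤ c) (hd : 0 < d) (hm0 : 0 ≤ m)
    (hq : 0 < q) (hq2 : q ≤ 1 / 2) (hA : 0 ≤ A) (hB : 0 ≤ B)
    (hAB : m * (c + d) ≤ c * A + d * B) (hBA : m * (c + d) ≤ c * B + d * A)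
    (hm : d * (m + 1) < (c + d) * q) (hne : A = m → B ≠ m) :
    (m + q) * (m + (1 - q)) < (A + q) * (B + (1 - q)) := by
  rcases le_or_gt A m with hAm | hAm
  · exact mul_add_lt_mul_add_of_le_corner hc hd hq hA hAm hAB hm hne
  rcases le_or_gt B m with hBm | hBm
  · have hm' : d * (m + 1) < (c + d) * (1 - q) :=
      hm.trans_le (mul_le_mul_of_nonneg_left (by linarith) (by linarith))
    have := mul_add_lt_mul_add_of_le_corner hc hd (by linarith) hB hBm hBA hm'
      fun _ => hAm.ne'
    linarith
  · exact mul_lt_mul'' (by linarith) (by linarith) (by linarith) (by linarith)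

/-- The estimator error factors in the coordinates `(1 - x) / s` and `(1 - y) / s`, where
`s = x + y - 1`. -/
theorem estimator_error_eq (x y q N : ℝ) (hs : x + y - 1 ≠ 0) :
    (1 / 4 - (x - 1 / 2 - q * (x + y - 1)) ^ 2) / ((x + y - 1) ^ 2 * N) =
      ((1 - x) / (x + y - 1) + q) * ((1 - y) / (x + y - 1) + (1 - q)) / N := by
  rw [← div_div]
  congr 1
  field_simp
  ring

/-- If `g(ε, δ) = δ(eᵉ + δ)/(eᵉ + 2δ - 1)² < π` with `0 < π ≤ 1/2`, then the mechanism
`p00 = p11 = (eᵉ + δ)/(eᵉ + 1)` is the unique (ε, δ)-differentially private randomised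
response mechanism minimising the estimator error over the feasible region `R'(ε, δ)`. -/
theorem stmt_14 (ε δ : ℝ) (hε : 0 ≤ ε) (hδ0 : 0 < δ) (hδ1 : δ ≤ 1) (n : ℕ) (hn : 0 < n)
    (π : ℝ) (hπ0 : 0 < π) (hπ2 : π ≤ 1 / 2)
    (hg : δ * (Real.exp ε + δ) / (Real.exp ε + 2 * δ - 1) ^ 2 < π) :
    let V : ℝ → ℝ → ℝ := fun x y =>
      (1 / 4 - (x - 1 / 2 - π * (x + y - 1)) ^ 2) / ((x + y - 1) ^ 2 * (n : ℝ))
    let R' : Set (ℝ × ℝ) := {p : ℝ × ℝ |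
      p.1 ≤ 1 ∧ p.2 ≤ 1 ∧ 1 < p.1 + p.2 ∧
      p.1 ≤ Real.exp ε * (1 - p.2) + δ ∧ p.2 ≤ Real.exp ε * (1 - p.1) + δ}
    let pStar : ℝ := (Real.exp ε + δ) / (Real.exp ε + 1)
    (pStar, pStar) ∈ R' ∧
    ∀ p ∈ R', p ≠ (pStar, pStar) → V pStar pStar < V p.1 p.2 := by
  have hE : 1 ≤ Real.exp ε := Real.one_le_exp hε
  generalize Real.exp ε = E at hE hg ⊢
  intro V R' pStar
  have hpE : pStar = (E + δ) / (E + 1) := rfl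
  clear_value pStar
  have hE1 : 0 < E + 1 := by linarith
  have hD : 0 < E + 2 * δ - 1 := by linarith
  have hD0 : E + 2 * δ - 1 ≠ 0 := hD.ne'
  have hp : pStar * (E + 1) = E + δ := by rw [hpE]; field_simp
  have hs : 2 * pStar - 1 = (E + 2 * δ - 1) / (E + 1) := by rw [hpE]; field_simp; ring
  have hs0 : 0 < 2 * pStar - 1 := hs ▸ div_pos hD hE1
  have hp1 : pStar ≤ 1 := by rw [hpE, div_le_one hE1]; linarith
  refine ⟨⟨hp1, hp1, ?_, ?_, ?_⟩, ?_⟩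
  · dsimp only; linarith
  · dsimp only; linarith
  · dsimp only; linarith
  rintro ⟨x, y⟩ ⟨hx, hy, hxy, h1, h2⟩ hne
  dsimp only at hx hy hxy h1 h2
  have hsxy : 0 < x + y - 1 := by linarith
  have hsp : 0 < pStar + pStar - 1 := by linarith
  simp only [V]
  rw [estimator_error_eq _ _ _ _ hsxy.ne', estimator_error_eq _ _ _ _ hsp.ne']
  refine div_lt_div_of_pos_right ?_ (Nat.cast_pos.mpr hn)
  have hm : (1 - pStar) / (pStar + pStar - 1) = (1 - δ) / (E + 2 * δ - 1) := by
    rw [div_eq_div_iff hsp.ne' hD0]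
    linear_combination -hp
  have hmD : (1 - δ) / (E + 2 * δ - 1) * ((E - 1 + δ) + δ) = 1 - δ := by
    rw [div_mul_eq_mul_div, div_eq_iff hD0]
    ring
  rw [hm]
  apply mul_add_lt_mul_add_of_corner (c := E - 1 + δ) (d := δ) (by linarith) hδ0
    (div_nonneg (by linarith) hD.le) hπ0 hπ2
    (div_nonneg (by linarith) hsxy.le) (div_nonneg (by linarith) hsxy.le)
  · rw [hmD, ← mul_div_assoc, ← mul_div_assoc, ← add_div, le_div_iff₀ hsxy]
    linarith
  · rw [hmD, ← mul_div_assoc, ← mul_div_assoc, ← add_div, le_div_iff₀ hsxy]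
    linarith
  · have h := mul_lt_mul_of_pos_right hg hD
    have h' : δ * ((1 - δ) / (E + 2 * δ - 1) + 1) =
        δ * (E + δ) / (E + 2 * δ - 1) ^ 2 * (E + 2 * δ - 1) := by
      rw [div_add_one hD0, pow_two, ← div_div, div_mul_cancel₀ _ hD0, mul_div_assoc]
      congr 2
      ring
    linarith
  · intro hA hB
    rw [div_eq_div_iff hsxy.ne' hD0] at hA hB
    have hxy' : x = y := by
      have : (x - y) * (E + 2 * δ - 1) = 0 := by linarith
      rcases mul_eq_zero.mp this with h | h <;> linarith
    subst hxy'
    have hx' : x = pStar := by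
      rw [hpE, eq_div_iff hE1.ne']
      linarith
    exact hne (by rw [hx'])
end

section
/- Let ε ≥ 0, 0 ≤ δ ≤ 1, let n be a positive integer, and let π be real. Define Warner's estimator error V_w(p, π, n) = (1/4 − (p − 1/2 − π(2p − 1))²) / ((2p − 1)²·n) for p ≠ 1/2, and set p* = (e^ε + δ)/(e^ε + 1). Then V_w is strictly decreasing on (1/2, 1] (for all 1/2 < p < q ≤ 1, V_w(q, π, n) < V_w(p, π, n)), and consequently for every p_w ∈ (1/2, p*] with p_w ≠ p* one has V_w(p*, π, n) < V_w(p_w, π, n); i.e., p_w = (e^ε + δ)/(e^ε + 1) is the unique minimiser of the estimator error among Warner randomised response mechanisms satisfying (ε, δ)-differential privacy with p_w > 1/2. -/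
/-- Warner's error splits into a term depending only on `2p - 1` and a term independent of `p`. -/
theorem warnerError_eq (π c : ℝ) {p : ℝ} (hp : 1 / 2 < p) :
    (1 / 4 - (p - 1 / 2 - π * (2 * p - 1)) ^ 2) / ((2 * p - 1) ^ 2 * c) =
      (1 / (4 * (2 * p - 1) ^ 2) - (1 / 2 - π) ^ 2) / c := by
  obtain ⟨t, rfl⟩ : ∃ t, p = (t + 1) / 2 := ⟨2 * p - 1, by ring⟩
  have ht : t ≠ 0 := by linarith
  rw [← div_div, show 2 * ((t + 1) / 2) - 1 = t by ring]
  congr 1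
  field_simp
  ring

/-- Warner's error is strictly decreasing in `p > 1 / 2`. -/
theorem warnerError_lt (π : ℝ) {c p q : ℝ} (hc : 0 < c) (hp : 1 / 2 < p) (hpq : p < q) :
    (1 / 4 - (q - 1 / 2 - π * (2 * q - 1)) ^ 2) / ((2 * q - 1) ^ 2 * c) <
      (1 / 4 - (p - 1 / 2 - π * (2 * p - 1)) ^ 2) / ((2 * p - 1) ^ 2 * c) := by
  rw [warnerError_eq π c hp, warnerError_eq π c (hp.trans hpq)]
  have ht : 0 < 2 * p - 1 := by linarith
  gcongr


/-- Warner's estimator error `V_w(p) = (1/4 - (p - 1/2 - π(2p - 1))²)/((2p - 1)²·n)` is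
strictly decreasing on `(1/2, 1]`; consequently `p_w = (eᵉ + δ)/(eᵉ + 1)` is the unique
minimiser of the error among Warner mechanisms with `p_w ∈ (1/2, (eᵉ + δ)/(eᵉ + 1)]`,
i.e. those satisfying (ε, δ)-differential privacy with `p_w > 1/2`. -/
theorem stmt_19 (ε δ : ℝ) (hε : 0 ≤ ε) (hδ0 : 0 ≤ δ) (hδ1 : δ ≤ 1)
    (n : ℕ) (hn : 0 < n) (π : ℝ) :
    let Vw : ℝ → ℝ := fun p =>
      (1 / 4 - (p - 1 / 2 - π * (2 * p - 1)) ^ 2) / ((2 * p - 1) ^ 2 * (n : ℝ))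
    let pStar : ℝ := (Real.exp ε + δ) / (Real.exp ε + 1)
    (∀ p q : ℝ, 1 / 2 < p → p < q → q ≤ 1 → Vw q < Vw p) ∧
    ∀ pw ∈ Set.Ioc (1 / 2 : ℝ) pStar, pw ≠ pStar → Vw pStar < Vw pw := by
  intro Vw pStar
  have hn' : (0 : ℝ) < n := Nat.cast_pos.mpr hn
  exact ⟨fun p q hp hpq _ => warnerError_lt π hn' hp hpq,
    fun pw hpw hne => warnerError_lt π hn' hpw.1 (lt_of_le_of_ne hpw.2 hne)⟩
end
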